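/- The elliptic curve y^2 = x^3 + x^2 + 2x + 1 over ℚ has exactly two affine rational points, namely (0, 1) and (0, -1). -/

import Mathlib

/-- The Eisenstein integers. -/
abbrev Eis := QuadraticAlgebra ℤ (-1) (-1)

lemma eis_norm (z : Eis) : QuadraticAlgebra.norm z = z.re ^ 2 - z.re * z.im + z.im ^ 2 := by
  rw [QuadraticAlgebra.norm_def]; ring

lemma eis_norm_nonneg (z : Eis) : 0 ≤ QuadraticAlgebra.norm z := by
  rw [eis_norm]; nlinarith [sq_nonneg (z.re - z.im), sq_nonneg z.re, sq_nonneg z.im]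

lemma eis_norm_pos {z : Eis} (hz : z ≠ 0) : 0 < QuadraticAlgebra.norm z := by
  by_contra h
  have h0 : z.re ^ 2 - z.re * z.im + z.im ^ 2 ≤ 0 := by rw [← eis_norm]; omega
  have h1 : z.re = 0 := by
    have : z.re ^ 2 ≤ 0 := by nlinarith [sq_nonneg (z.re - 2 * z.im)]
    exact pow_eq_zero_iff (two_ne_zero) |>.1 (le_antisymm this (sq_nonneg _))
  have h2 : z.im = 0 := by
    have : z.im ^ 2 ≤ 0 := by nlinarith [sq_nonneg (z.im - 2 * z.re)]
    exact pow_eq_zero_iff (two_ne_zero) |>.1 (le_antisymm this (sq_nonneg _))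
  exact hz (QuadraticAlgebra.ext h1 h2)

lemma round_bound (p n : ℤ) (hn : 0 < n) : |2 * (p - n * round ((p : ℚ) / n))| ≤ n := by
  have h := abs_sub_round ((p : ℚ) / n)
  have hn' : (0 : ℚ) < n := by exact_mod_cast hn
  have h2 : |2 * ((p : ℚ) - n * round ((p : ℚ) / n))| ≤ n := by
    have : 2 * ((p : ℚ) - n * round ((p : ℚ) / n)) = (2 * n) * ((p : ℚ) / n - round ((p : ℚ) / n)) := by
      field_simp
    rw [this, abs_mul, abs_of_pos (by positivity)]
    nlinarith
  exact_mod_cast h2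

noncomputable def eisDiv (x y : Eis) : Eis :=
  ⟨round (((x * star y).re : ℚ) / (QuadraticAlgebra.norm y : ℤ)),
    round (((x * star y).im : ℚ) / (QuadraticAlgebra.norm y : ℤ))⟩

lemma eis_mod_lt (x : Eis) {y : Eis} (hy : y ≠ 0) :
    QuadraticAlgebra.norm (x - y * eisDiv x y) < QuadraticAlgebra.norm y := by
  have hN := eis_norm_pos hy
  have h1 := round_bound (x * star y).re (QuadraticAlgebra.norm y) hN
  have h2 := round_bound (x * star y).im (QuadraticAlgebra.norm y) hN
  have key : QuadraticAlgebra.norm (x - y * eisDiv x y) * QuadraticAlgebra.norm y =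
      ((x * star y).re - QuadraticAlgebra.norm y * (eisDiv x y).re) ^ 2
      - ((x * star y).re - QuadraticAlgebra.norm y * (eisDiv x y).re) *
        ((x * star y).im - QuadraticAlgebra.norm y * (eisDiv x y).im)
      + ((x * star y).im - QuadraticAlgebra.norm y * (eisDiv x y).im) ^ 2 := by
    generalize eisDiv x y = q
    simp only [eis_norm, QuadraticAlgebra.re_mul, QuadraticAlgebra.im_mul,
      QuadraticAlgebra.re_sub, QuadraticAlgebra.im_sub, QuadraticAlgebra.re_star,
      QuadraticAlgebra.im_star]
    ring
  change |2 * ((x * star y).re - QuadraticAlgebra.norm y * (eisDiv x y).re)| ≤ _ at h1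
  change |2 * ((x * star y).im - QuadraticAlgebra.norm y * (eisDiv x y).im)| ≤ _ at h2
  generalize (x * star y).re - QuadraticAlgebra.norm y * (eisDiv x y).re = r at *
  generalize (x * star y).im - QuadraticAlgebra.norm y * (eisDiv x y).im = s at *
  generalize QuadraticAlgebra.norm (x - y * eisDiv x y) = M at *
  generalize QuadraticAlgebra.norm y = N at *
  rw [abs_le] at h1 h2
  have a1 : 4 * r ^ 2 ≤ N ^ 2 := by nlinarith
  have a2 : 4 * s ^ 2 ≤ N ^ 2 := by nlinarith
  have a3 : 4 * (-(r * s)) ≤ N ^ 2 := by nlinarith [sq_nonneg (r + s)]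
  by_contra hc
  push Not at hc
  nlinarith

noncomputable instance eisEuclid : EuclideanDomain Eis :=
  { (inferInstance : CommRing Eis), (inferInstance : Nontrivial Eis) with
    quotient := eisDiv
    remainder := fun x y => x - y * eisDiv x y
    quotient_zero := by
      intro a
      refine QuadraticAlgebra.ext ?_ ?_ <;> simp [eisDiv]
    quotient_mul_add_remainder_eq := fun x y => by ring
    r := fun a b => (QuadraticAlgebra.norm a).natAbs < (QuadraticAlgebra.norm b).natAbs
    r_wellFounded := (measure (fun z : Eis => (QuadraticAlgebra.norm z).natAbs)).wf
    remainder_lt := fun x y hy => by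
      have := eis_mod_lt x hy
      have := eis_norm_nonneg (x - y * eisDiv x y)
      omega
    mul_left_not_lt := fun a b hb => by
      have h1 := eis_norm_pos hb
      have h2 := eis_norm_nonneg a
      rw [map_mul, Int.natAbs_mul, not_lt]
      exact Nat.le_mul_of_pos_right _ (by omega) }

lemma eis_unit {z : Eis} (hz : QuadraticAlgebra.norm z = 1) :
    (z.re = 1 ∧ z.im = 0) ∨ (z.re = -1 ∧ z.im = 0) ∨ (z.re = 0 ∧ z.im = 1) ∨
    (z.re = 0 ∧ z.im = -1) ∨ (z.re = 1 ∧ z.im = 1) ∨ (z.re = -1 ∧ z.im = -1) := by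
  rw [eis_norm] at hz
  have h1 : z.re ≤ 1 := by nlinarith [sq_nonneg (z.re - 2 * z.im)]
  have h2 : -1 ≤ z.re := by nlinarith [sq_nonneg (z.re - 2 * z.im)]
  have h3 : z.im ≤ 1 := by nlinarith [sq_nonneg (z.im - 2 * z.re)]
  have h4 : -1 ≤ z.im := by nlinarith [sq_nonneg (z.im - 2 * z.re)]
  generalize z.re = a at *
  generalize z.im = b at *
  interval_cases a <;> interval_cases b <;> simp_all

/-- Every Eisenstein cube is the cube of an element of `ℤ[√-3]`. -/
lemma eis_cube (d : Eis) : ∃ u v : ℤ, d ^ 3 =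
    ⟨(u ^ 3 - 9 * u * v ^ 2) + (3 * u ^ 2 * v - 3 * v ^ 3), 2 * (3 * u ^ 2 * v - 3 * v ^ 3)⟩ := by
  obtain ⟨p, q⟩ := d
  have hc : (⟨p, q⟩ : Eis) ^ 3 = ⟨p ^ 3 - 3 * p * q ^ 2 + q ^ 3, 3 * p ^ 2 * q - 3 * p * q ^ 2⟩ := by
    rw [pow_succ, pow_succ, pow_one]
    refine QuadraticAlgebra.ext ?_ ?_ <;>
    simp only [QuadraticAlgebra.re_mul, QuadraticAlgebra.im_mul] <;> ring
  rw [hc]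
  rcases Int.even_or_odd' q with ⟨v, hq | hq⟩
  · refine ⟨p - v, v, ?_⟩
    subst hq
    refine QuadraticAlgebra.ext ?_ ?_ <;> dsimp only <;> ring
  · rcases Int.even_or_odd' p with ⟨w, hp | hp⟩
    · refine ⟨q - w, -w, ?_⟩
      subst hp
      refine QuadraticAlgebra.ext ?_ ?_ <;> dsimp only <;> ring
    · -- multiply by ω
      refine ⟨-q - (w - v), w - v, ?_⟩
      subst hp hq
      refine QuadraticAlgebra.ext ?_ ?_ <;> dsimp only <;> ring

lemma euler_cube {A B U : ℤ} (h : A ^ 2 + 3 * B ^ 2 = U ^ 3) (hU : Odd U) (hc : IsCoprime A U) :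
    ∃ u v : ℤ, A = u ^ 3 - 9 * u * v ^ 2 ∧ B = 3 * u ^ 2 * v - 3 * v ^ 3 ∧
      U = u ^ 2 + 3 * v ^ 2 := by
  have hc2 : IsCoprime (2 * A) (U ^ 3) := by
    apply IsCoprime.pow_right
    apply IsCoprime.mul_left _ hc
    obtain ⟨k, hk⟩ := hU
    exact ⟨-k, 1, by rw [hk]; ring⟩
  obtain ⟨r, s, hrs⟩ := hc2
  have hco : IsCoprime (⟨A + B, 2 * B⟩ : Eis) ⟨A - B, -(2 * B)⟩ := by
    refine ⟨⟨r, 0⟩ + ⟨s, 0⟩ * ⟨A - B, -(2 * B)⟩, ⟨r, 0⟩, ?_⟩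
    refine QuadraticAlgebra.ext ?_ ?_ <;>
    simp only [QuadraticAlgebra.re_mul, QuadraticAlgebra.im_mul, QuadraticAlgebra.re_add,
      QuadraticAlgebra.im_add, QuadraticAlgebra.re_one, QuadraticAlgebra.im_one]
    · linear_combination hrs + s * h
    · ring
  have hmul : (⟨A + B, 2 * B⟩ : Eis) * ⟨A - B, -(2 * B)⟩ = (⟨U, 0⟩ : Eis) ^ 3 := by
    rw [pow_succ, pow_succ, pow_one]
    refine QuadraticAlgebra.ext ?_ ?_ <;>
    simp only [QuadraticAlgebra.re_mul, QuadraticAlgebra.im_mul]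
    · linear_combination h
    · ring
  obtain ⟨d, w, hd⟩ := exists_associated_pow_of_mul_eq_pow' hco hmul
  obtain ⟨u, v, huv⟩ := eis_cube d
  rw [huv] at hd
  have hw : QuadraticAlgebra.norm (w : Eis) = 1 := by
    have h1 := QuadraticAlgebra.isUnit_iff_norm_isUnit.1 w.isUnit
    rcases Int.isUnit_iff.1 h1 with h1 | h1
    · exact h1
    · have := eis_norm_nonneg (w : Eis); omega
  have hUo : Odd (A ^ 2 + 3 * B ^ 2) := by rw [h]; exact hU.pow
  have fin : ∀ u v : ℤ, A = u ^ 3 - 9 * u * v ^ 2 → B = 3 * u ^ 2 * v - 3 * v ^ 3 →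
      ∃ u v : ℤ, A = u ^ 3 - 9 * u * v ^ 2 ∧ B = 3 * u ^ 2 * v - 3 * v ^ 3 ∧
      U = u ^ 2 + 3 * v ^ 2 := by
    intro u v hA hB
    refine ⟨u, v, hA, hB, ?_⟩
    have : U ^ 3 = (u ^ 2 + 3 * v ^ 2) ^ 3 := by rw [← h, hA, hB]; ring
    exact (Odd.strictMono_pow (by decide : Odd 3)).injective this
  have hbad : ¬ ((2 : ℤ) ∣ A + B) := by
    rintro ⟨k, hk⟩
    have : A = 2 * k - B := by omega
    rw [this] at hUo
    have h2 : (2 * k - B) ^ 2 + 3 * B ^ 2 = 2 * (2 * k ^ 2 - 2 * k * B + 2 * B ^ 2) := by ring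
    rw [h2] at hUo
    exact absurd hUo (by simp)
  have e1 := congrArg QuadraticAlgebra.re hd
  have e2 := congrArg QuadraticAlgebra.im hd
  simp only [QuadraticAlgebra.re_mul, QuadraticAlgebra.im_mul] at e1 e2
  rcases eis_unit hw with ⟨h1, h2⟩ | ⟨h1, h2⟩ | ⟨h1, h2⟩ | ⟨h1, h2⟩ | ⟨h1, h2⟩ | ⟨h1, h2⟩ <;>
    rw [h1, h2] at e1 e2
  · refine fin u v ?_ ?_ <;> linarith
  · refine fin (-u) (-v) ?_ ?_ <;> ring_nf <;> linarith
  all_goals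
    exfalso
    apply hbad
    generalize u ^ 3 - 9 * u * v ^ 2 = a at *
    generalize 3 * u ^ 2 * v - 3 * v ^ 3 = b at *
    omega

lemma rat_form {a b c : ℤ} {x y : ℚ} (h : y ^ 2 = x ^ 3 + a * x ^ 2 + b * x + c) :
    ∃ X Y Z : ℤ, Z ≠ 0 ∧ IsCoprime X Z ∧ x = X / Z ^ 2 ∧ y = Y / Z ^ 3 ∧
      Y ^ 2 = X ^ 3 + a * X ^ 2 * Z ^ 2 + b * X * Z ^ 4 + c * Z ^ 6 := by
  obtain ⟨X, D, hD, hco, hx⟩ : ∃ X D : ℤ, 0 < D ∧ IsCoprime X D ∧ x = X / D := by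
    refine ⟨x.num, x.den, by exact_mod_cast x.pos, ?_, by exact_mod_cast (Rat.num_div_den x).symm⟩
    rw [Int.isCoprime_iff_gcd_eq_one]; exact x.reduced
  have hDq : (D : ℚ) ≠ 0 := by exact_mod_cast hD.ne'
  have h1 : (y * D ^ 2) ^ 2 = ((D * (X ^ 3 + a * X ^ 2 * D + b * X * D ^ 2 + c * D ^ 3) : ℤ) : ℚ) := by
    rw [mul_pow, h, hx]; push_cast; field_simp
  obtain ⟨M, hM⟩ : ∃ M : ℤ, y * D ^ 2 = M := by
    have hs : IsSquare (((D * (X ^ 3 + a * X ^ 2 * D + b * X * D ^ 2 + c * D ^ 3) : ℤ) : ℚ)) :=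
      ⟨y * D ^ 2, by rw [← h1]; ring⟩
    rw [Rat.isSquare_intCast_iff] at hs
    obtain ⟨r, hr⟩ := hs
    have : (y * D ^ 2) ^ 2 = (r : ℚ) ^ 2 := by rw [h1, hr]; push_cast; ring
    rcases sq_eq_sq_iff_eq_or_eq_neg.1 this with h | h
    · exact ⟨r, h⟩
    · exact ⟨-r, by rw [h]; push_cast; ring⟩
  rw [hM] at h1
  have h2 : D * (X ^ 3 + a * X ^ 2 * D + b * X * D ^ 2 + c * D ^ 3) = M ^ 2 := by
    exact_mod_cast h1.symm
  have hcop : IsCoprime D (X ^ 3 + a * X ^ 2 * D + b * X * D ^ 2 + c * D ^ 3) := by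
    have : X ^ 3 + a * X ^ 2 * D + b * X * D ^ 2 + c * D ^ 3
      = X ^ 3 + D * (a * X ^ 2 + b * X * D + c * D ^ 2) := by ring
    rw [this]
    exact (hco.symm.pow_right).add_mul_left_right _
  obtain ⟨z, hz⟩ := Int.sq_of_isCoprime hcop h2
  have hz : D = z ^ 2 := by
    rcases hz with h | h
    · exact h
    · nlinarith [sq_nonneg z]
  have hz0 : z ≠ 0 := by rintro rfl; simp at hz; omega
  have hzM : z ∣ M := by
    have : z ^ 2 ∣ M ^ 2 := by rw [← h2, ← hz]; exact dvd_mul_right _ _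
    exact (Int.pow_dvd_pow_iff two_ne_zero).1 this
  obtain ⟨Y, hY⟩ := hzM
  have hzq : (z : ℚ) ≠ 0 := by exact_mod_cast hz0
  refine ⟨X, Y, z, hz0, ?_, ?_, ?_, ?_⟩
  · rw [hz] at hco; exact (IsCoprime.pow_right_iff two_pos).1 hco
  · rw [hx, hz]; push_cast; rfl
  · rw [hY, hz] at hM; push_cast at hM; field_simp; 
    apply mul_right_cancel₀ hzq; linear_combination hM
  · rw [hY, hz] at h2
    apply mul_left_cancel₀ (pow_ne_zero 2 hz0)
    linear_combination -h2

def tau (x : ℚ) : ℚ := -46 * x ^ 2 / (3 * x ^ 3 + 4 * x ^ 2 + 12 * x + 12)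

/-- points of `E` with trivial class -/
def SS (a b : ℚ) : Prop := b ^ 3 - a ^ 3 = 2 * (a * b + 1)

lemma val3 {x y : ℚ} (hx : x ≠ 0) (h : y ^ 2 = x ^ 3 + x ^ 2 + 2 * x + 1) :
    ∃ p q : ℤ, 3 ∣ p ∧ ¬ 3 ∣ q ∧ p ≠ 0 ∧ tau x = p / q ∧
      (padicValRat 3 x < 0 → padicValRat 3 (p : ℚ) = - padicValRat 3 x - 1) := by
  obtain ⟨X, Y, Z, hZ, hco, hxX, -, hE⟩ := rat_form (a := 1) (b := 2) (c := 1) (x := x) (y := y)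
    (by push_cast; linarith)
  have hX : X ≠ 0 := by rintro rfl; apply hx; rw [hxX]; simp
  have hXZ : ¬ (3 ∣ X ∧ 3 ∣ Z) := by
    rintro ⟨h1, h2⟩
    have := hco.isUnit_of_dvd' h1 h2
    rw [Int.isUnit_iff] at this; omega
  have h3 : 3 ∣ X ∨ 3 ∣ Z := by
    have key : ∀ X Y Z : ZMod 3, Y ^ 2 = X ^ 3 + 1 * X ^ 2 * Z ^ 2 + 2 * X * Z ^ 4 + 1 * Z ^ 6 →
      X = 0 ∨ Z = 0 := by decide
    have := key X Y Z (by have := congrArg (Int.cast : ℤ → ZMod 3) hE; push_cast at this; exact this)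
    rcases this with h | h
    · left; exact (ZMod.intCast_zmod_eq_zero_iff_dvd X 3).1 h
    · right; exact (ZMod.intCast_zmod_eq_zero_iff_dvd Z 3).1 h
  have hm : (3 : ℤ) ∣ X ^ 2 * Z ^ 2 ∧ ∃ m, X * Z = 3 * m := by
    rcases h3 with ⟨k, hk⟩ | ⟨k, hk⟩
    · exact ⟨⟨3 * k ^ 2 * Z ^ 2, by rw [hk]; ring⟩, ⟨k * Z, by rw [hk]; ring⟩⟩
    · exact ⟨⟨3 * k ^ 2 * X ^ 2, by rw [hk]; ring⟩, ⟨X * k, by rw [hk]; ring⟩⟩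
  obtain ⟨-, m, hm⟩ := hm
  have hm0 : m ≠ 0 := by
    rintro rfl
    rcases mul_eq_zero.1 (hm.trans (mul_zero _)) with h | h <;> contradiction
  set q : ℤ := X ^ 3 + 12 * m ^ 2 + 4 * X * Z ^ 4 + 4 * Z ^ 6 with hq
  have hq3 : ¬ 3 ∣ q := by
    intro hd
    have key : ∀ X Z m : ZMod 3, X = 0 ∨ Z = 0 →
      X ^ 3 + 12 * m ^ 2 + 4 * X * Z ^ 4 + 4 * Z ^ 6 = 0 → X = 0 ∧ Z = 0 := by decide
    have h1 : (q : ZMod 3) = 0 := (ZMod.intCast_zmod_eq_zero_iff_dvd q 3).2 hd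
    rw [hq] at h1; push_cast at h1
    obtain ⟨k1, k2⟩ := key X Z m (by
      rcases h3 with h | h
      · left; exact (ZMod.intCast_zmod_eq_zero_iff_dvd X 3).2 h
      · right; exact (ZMod.intCast_zmod_eq_zero_iff_dvd Z 3).2 h) h1
    exact hXZ ⟨(ZMod.intCast_zmod_eq_zero_iff_dvd X 3).1 k1,
      (ZMod.intCast_zmod_eq_zero_iff_dvd Z 3).1 k2⟩
  have hq0 : q ≠ 0 := by rintro h; rw [h] at hq3; simp at hq3
  have : Fact (Nat.Prime 3) := ⟨by norm_num⟩
  have hZq : (Z : ℚ) ≠ 0 := by exact_mod_cast hZ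
  have hXq : (X : ℚ) ≠ 0 := by exact_mod_cast hX
  have hmq : (m : ℚ) ≠ 0 := by exact_mod_cast hm0
  have hqq : (q : ℚ) ≠ 0 := by exact_mod_cast hq0
  have hmq' : (X : ℚ) * Z = 3 * m := by exact_mod_cast hm
  refine ⟨-46 * (3 * m ^ 2), q, ⟨-46 * m ^ 2, by ring⟩, hq3, by positivity, ?_, ?_⟩
  · have hden : 3 * x ^ 3 + 4 * x ^ 2 + 12 * x + 12 = 3 * q / Z ^ 6 := by
      rw [hxX, hq]; push_cast; field_simp
      linear_combination 4 * (X * Z + 3 * m) * hmq'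
    rw [tau, hden, hxX]
    push_cast
    field_simp
    linear_combination -(X * Z + 3 * m) * hmq'
  · intro hv
    have vx : padicValRat 3 x = padicValInt 3 X - 2 * padicValInt 3 Z := by
      rw [hxX, padicValRat.div hXq (pow_ne_zero _ hZq), padicValRat.pow]
      simp
    have vm : padicValRat 3 ((X : ℚ) * Z) = padicValRat 3 (3 * (m : ℚ)) := by rw [hmq']
    rw [padicValRat.mul hXq hZq, padicValRat.mul (by norm_num) hmq] at vm
    have v3 : padicValRat 3 (3 : ℚ) = 1 := by
      exact_mod_cast padicValRat.self (p := 3) (by norm_num)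
    have v46 : padicValRat 3 (46 : ℚ) = 0 := by
      have : padicValRat 3 ((46 : ℤ) : ℚ) = 0 := by
        rw [padicValRat.of_int, padicValInt.eq_zero_of_not_dvd (by norm_num)]; rfl
      rwa [Int.cast_ofNat] at this
    push_cast
    rw [padicValRat.mul (by norm_num) (by positivity), padicValRat.mul (by norm_num) (by positivity),
      padicValRat.pow, padicValRat.neg, v3, v46]
    rw [v3] at vm
    simp only [padicValRat.of_int] at *
    have hX0 : padicValInt 3 X = 0 := by
      apply padicValInt.eq_zero_of_not_dvd
      intro hd
      have : padicValInt 3 Z = 0 := padicValInt.eq_zero_of_not_dvd (fun h' => hXZ ⟨hd, h'⟩)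
      omega
    push_cast
    omega

lemma val_step {x t : ℚ} (p q : ℤ) (hp : 3 ∣ p) (hp0 : p ≠ 0) (hq : ¬ 3 ∣ q) (ht : t = p / q)
    (h : 27 * t * x = -(t ^ 3 - 6 * t ^ 2 + 12 * t + 46)) :
    padicValRat 3 x = -3 - padicValRat 3 (p : ℚ) := by
  have hq0 : q ≠ 0 := by rintro h; rw [h] at hq; simp at hq
  have hqq : (q : ℚ) ≠ 0 := by exact_mod_cast hq0
  have hpq : (p : ℚ) ≠ 0 := by exact_mod_cast hp0
  set M : ℤ := -(p ^ 3 - 6 * p ^ 2 * q + 12 * p * q ^ 2 + 46 * q ^ 3) with hM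
  have hM3 : ¬ 3 ∣ M := by
    intro hd
    have key : ∀ p q : ZMod 3, p = 0 →
      -(p ^ 3 - 6 * p ^ 2 * q + 12 * p * q ^ 2 + 46 * q ^ 3) = 0 → q = 0 := by decide
    have h1 : (M : ZMod 3) = 0 := (ZMod.intCast_zmod_eq_zero_iff_dvd M 3).2 hd
    rw [hM] at h1; push_cast at h1
    exact hq ((ZMod.intCast_zmod_eq_zero_iff_dvd q 3).1
      (key p q ((ZMod.intCast_zmod_eq_zero_iff_dvd p 3).2 hp) h1))
  have : Fact (Nat.Prime 3) := ⟨by norm_num⟩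
  have hM0 : M ≠ 0 := by rintro h; rw [h] at hM3; simp at hM3
  have hMq : (M : ℚ) ≠ 0 := by exact_mod_cast hM0
  have hx : x = M / (3 ^ 3 * p * q ^ 2) := by
    rw [ht] at h
    rw [hM]; push_cast
    field_simp
    field_simp at h
    linear_combination h
  have v3 : padicValRat 3 (3 : ℚ) = 1 := by
    exact_mod_cast padicValRat.self (p := 3) (by norm_num)
  rw [hx, padicValRat.div hMq (by positivity), padicValRat.mul (by positivity) (by positivity),
    padicValRat.mul (by positivity) hpq, padicValRat.pow, padicValRat.pow, v3]
  simp only [padicValRat.of_int, padicValInt.eq_zero_of_not_dvd hM3,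
    padicValInt.eq_zero_of_not_dvd hq]
  push_cast; ring

lemma cube_class {x y : ℚ} (h : y ^ 2 = x ^ 3 + x ^ 2 + 2 * x + 1) :
    (∃ c d : ℚ, y - x - 1 = c ^ 3 ∧ y + x + 1 = d ^ 3 ∧ x = c * d) ∨
    (∃ c d : ℚ, y - x - 1 = 2 * c ^ 3 ∧ y + x + 1 = 4 * d ^ 3 ∧ x = 2 * c * d) ∨
    (∃ c d : ℚ, y - x - 1 = 4 * c ^ 3 ∧ y + x + 1 = 2 * d ^ 3 ∧ x = 2 * c * d) := by
  obtain ⟨X, Y, Z, hZ, hco, hxX, hyY, hE⟩ := rat_form (a := 1) (b := 2) (c := 1) (x := x) (y := y)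
    (by push_cast; linarith)
  have hZq : (Z : ℚ) ≠ 0 := by exact_mod_cast hZ
  have e1 : y - x - 1 = ((Y - Z * (X + Z ^ 2) : ℤ) : ℚ) / Z ^ 3 := by
    rw [hxX, hyY]; push_cast; field_simp; ring
  have e2 : y + x + 1 = ((Y + Z * (X + Z ^ 2) : ℤ) : ℚ) / Z ^ 3 := by
    rw [hxX, hyY]; push_cast; field_simp; ring
  have hcoZ : IsCoprime X (Z * (X + Z ^ 2)) := by
    apply hco.mul_right
    have := (hco.pow_right (n := 2)).add_mul_left_right 1
    rwa [mul_one, add_comm] at this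
  have inj : ∀ a b : ℤ, a ^ 3 = b ^ 3 → a = b := fun a b h =>
    (Odd.strictMono_pow (by decide : Odd 3)).injective h
  rcases Int.even_or_odd' X with ⟨X1, hX | hX⟩
  · right
    have hZo : Odd Z := by
      rcases Int.even_or_odd Z with hz | hz
      · have := hco.isUnit_of_dvd' (⟨X1, hX⟩ : (2 : ℤ) ∣ X) hz.two_dvd
        rw [Int.isUnit_iff] at this; omega
      · exact hz
    have hKo : Odd (Z * (X + Z ^ 2)) := by
      apply hZo.mul; rw [hX]; exact (even_two_mul X1).add_odd hZo.pow
    have hYo : Odd Y := by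
      have : Odd (Y ^ 2) := by
        have : Y ^ 2 = 2 * (4 * X1 ^ 3) + (Z * (X + Z ^ 2)) ^ 2 := by
          rw [hE, hX]; ring
        rw [this]; exact (even_two_mul _).add_odd hKo.pow
      exact (Int.odd_pow' two_ne_zero).1 this
    generalize hK : Z * (X + Z ^ 2) = K at *
    obtain ⟨F, hF⟩ := (hYo.sub_odd hKo).two_dvd
    have hF' : Y + K = 2 * (F + K) := by linarith
    have hprod : F * (F + K) = 2 * X1 ^ 3 := by
      have : (Y - K) * (Y + K) = X ^ 3 := by rw [← hK]; linear_combination hE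
      rw [hF, hF', hX] at this; linarith
    have hcoK : IsCoprime X1 K := by
      rw [hX] at hcoZ; exact hcoZ.of_mul_left_right
    rcases Int.even_or_odd' F with ⟨G, hG | hG⟩
    · right
      have hp : G * (F + K) = X1 ^ 3 := by rw [hG] at hprod ⊢; linarith
      have hcc : IsCoprime G (F + K) := by
        have h1 : IsCoprime G K := IsCoprime.of_isCoprime_of_dvd_left (hcoK.pow_left (m := 3)) ⟨_, hp.symm⟩
        have := h1.add_mul_left_right 2
        rw [hG]; rwa [mul_comm G 2, add_comm] at this
      obtain ⟨⟨c, hc⟩, ⟨d, hd⟩⟩ := Int.eq_pow_of_mul_eq_pow_odd hcc (by decide) hp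
      have hcd : X1 = c * d := inj _ _ (by rw [← hp, hc, hd]; ring)
      refine ⟨c / Z, d / Z, ?_, ?_, ?_⟩
      · rw [e1, hF, hG, hc]; push_cast; field_simp; try ring
      · rw [e2, hF', hd]; push_cast; field_simp
      · rw [hxX, hX, hcd]; push_cast; field_simp
    · left
      obtain ⟨k, hk⟩ := hKo
      obtain ⟨G, hG'⟩ : ∃ G, F + K = 2 * G := ⟨G + k + 1, by omega⟩
      have hp : F * G = X1 ^ 3 := by rw [hG'] at hprod; linarith
      have hcc : IsCoprime F G := by
        have h1 : IsCoprime G K := IsCoprime.of_isCoprime_of_dvd_left (hcoK.pow_left (m := 3))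
          ⟨F, by rw [← hp]; ring⟩
        have := (h1.neg_right).add_mul_left_right 2
        have h2 : F = -K + G * 2 := by linarith
        rw [h2]; exact this.symm
      obtain ⟨⟨c, hc⟩, ⟨d, hd⟩⟩ := Int.eq_pow_of_mul_eq_pow_odd hcc (by decide) hp
      have hcd : X1 = c * d := inj _ _ (by rw [← hp, hc, hd]; ring)
      refine ⟨c / Z, d / Z, ?_, ?_, ?_⟩
      · rw [e1, hF, hc]; push_cast; field_simp
      · rw [e2, hF', hG', hd]; push_cast; field_simp; try ring
      · rw [hxX, hX, hcd]; push_cast; field_simp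
  · left
    generalize hK : Z * (X + Z ^ 2) = K at *
    have hp : (Y - K) * (Y + K) = X ^ 3 := by rw [← hK]; linear_combination hE
    have h2 : IsCoprime X (2 * K) := by
      refine IsCoprime.mul_right ⟨1, -X1, by rw [hX]; ring⟩ hcoZ
    have hcc : IsCoprime (Y - K) (Y + K) := by
      have h1 : IsCoprime (Y - K) (2 * K) :=
        IsCoprime.of_isCoprime_of_dvd_left (h2.pow_left (m := 3)) ⟨_, hp.symm⟩
      have := h1.add_mul_left_right 1
      have h3 : Y + K = 2 * K + (Y - K) * 1 := by ring
      rw [h3]; exact this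
    obtain ⟨⟨c, hc⟩, ⟨d, hd⟩⟩ := Int.eq_pow_of_mul_eq_pow_odd hcc (by decide) hp
    have hcd : X = c * d := inj _ _ (by rw [← hp, hc, hd]; ring)
    refine ⟨c / Z, d / Z, ?_, ?_, ?_⟩
    · rw [e1, hc]; push_cast; field_simp
    · rw [e2, hd]; push_cast; field_simp
    · rw [hxX, hcd]; push_cast; field_simp

lemma tr_aux {x y c d : ℚ} (hx : x ≠ 0)
    (h1 : y - x - 1 = 2 * c ^ 3) (h2 : y + x + 1 = 4 * d ^ 3) (h3 : x = 2 * c * d) :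
    ∃ a b, SS a b ∧ tau (a * b) = tau x := by
  have hc : c ≠ 0 := by rintro rfl; simp at h3; exact hx h3
  have hd : d ≠ 0 := by rintro rfl; simp at h3; exact hx h3
  have hr : 2 * d ^ 3 - c ^ 3 = 2 * c * d + 1 := by rw [h3] at h1 h2; linarith
  refine ⟨-1 / d, c / d, ?_, ?_⟩
  · unfold SS; field_simp; linear_combination -hr
  · have e1 : -1 / d * (c / d) = -c / d ^ 2 := by field_simp
    have e2 : 3 * (-c / d ^ 2) ^ 3 + 4 * (-c / d ^ 2) ^ 2 + 12 * (-c / d ^ 2) + 12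
       = (3 * x ^ 3 + 4 * x ^ 2 + 12 * x + 12) * (-c / d ^ 2) ^ 2 / x ^ 2 := by
      rw [h3]; field_simp
      linear_combination (24 * d ^ 3 + 12) * hr
    unfold tau
    rw [e1, e2]
    by_cases hD : 3 * x ^ 3 + 4 * x ^ 2 + 12 * x + 12 = 0
    · rw [hD]; simp
    · have : (-c / d ^ 2) ≠ 0 := div_ne_zero (neg_ne_zero.2 hc) (pow_ne_zero _ hd)
      generalize (-c / d ^ 2) = w at *
      field_simp

lemma tr {x y : ℚ} (hx : x ≠ 0) (h : y ^ 2 = x ^ 3 + x ^ 2 + 2 * x + 1) :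
    ∃ a b, SS a b ∧ tau (a * b) = tau x := by
  rcases cube_class h with ⟨c, d, h1, h2, h3⟩ | ⟨c, d, h1, h2, h3⟩ | ⟨c, d, h1, h2, h3⟩
  · refine ⟨c, d, ?_, by rw [h3]⟩
    unfold SS; rw [← h1, ← h2, ← h3]; ring
  · exact tr_aux hx h1 h2 h3
  · exact tr_aux (x := x) (y := -y) (c := -d) (d := -c) hx (by linear_combination -h2)
      (by linear_combination -h1) (by rw [h3]; ring)

lemma dual_cube {x y : ℚ} (h : y ^ 2 = x ^ 3 - 27 * (x + 23) ^ 2) :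
    ∃ u v : ℚ, x / 3 = u ^ 2 + 3 * v ^ 2 ∧ 23 + x = u ^ 3 - 9 * u * v ^ 2 := by
  obtain ⟨U, W, V, hV, hco, hxU, -, hE⟩ := rat_form (a := -27) (b := -1242) (c := -14283)
    (x := x) (y := y) (by push_cast; linear_combination h)
  have hVq : (V : ℚ) ≠ 0 := by exact_mod_cast hV
  have hE' : W ^ 2 + 27 * (V * (U + 23 * V ^ 2)) ^ 2 = U ^ 3 := by linear_combination hE
  have hUo : Odd U := by
    rcases Int.even_or_odd' U with ⟨k, hk | hk⟩
    · exfalso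
      have hVo : ¬ (2 : ℤ) ∣ V := fun hz => by
        have := hco.isUnit_of_dvd' (⟨k, hk⟩ : (2 : ℤ) ∣ U) hz
        rw [Int.isUnit_iff] at this; omega
      obtain ⟨l, hl⟩ : ∃ l, V = 2 * l + 1 := ⟨V / 2, by omega⟩
      have key : ∀ w k l : ZMod 8,
        w ^ 2 + 27 * ((2 * l + 1) * (2 * k + 23 * (2 * l + 1) ^ 2)) ^ 2 ≠ (2 * k) ^ 3 := by decide
      apply key W k l
      rw [hk, hl] at hE'
      have := congrArg (Int.cast : ℤ → ZMod 8) hE'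
      push_cast at this; exact this
    · exact ⟨k, hk⟩
  have p23 : Prime (23 : ℤ) := by norm_num
  have p3 : Prime (3 : ℤ) := by norm_num
  have h23 : ¬ (23 : ℤ) ∣ U := by
    rintro ⟨U', hU'⟩
    have hV23 : ¬ (23 : ℤ) ∣ V := fun hz => by
      have := hco.isUnit_of_dvd' (⟨U', hU'⟩ : (23 : ℤ) ∣ U) hz
      rw [Int.isUnit_iff] at this; omega
    have hW : (23 : ℤ) ∣ W := by
      apply p23.dvd_of_dvd_pow (n := 2)
      refine ⟨23 * (23 * U' ^ 3) - 23 * 27 * (V * (U' + V ^ 2)) ^ 2, ?_⟩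
      rw [hU'] at hE'; linear_combination hE'
    obtain ⟨W', hW'⟩ := hW
    have e : W' ^ 2 + 27 * (V * (U' + V ^ 2)) ^ 2 = 23 * U' ^ 3 := by
      rw [hU', hW'] at hE'
      apply mul_left_cancel₀ (show (529 : ℤ) ≠ 0 by norm_num)
      linear_combination hE'
    have key : ∀ a b : ZMod 23, a ^ 2 + 27 * b ^ 2 = 0 → a = 0 ∧ b = 0 := by decide
    obtain ⟨k1, k2⟩ := key (W' : ℤ) ((V * (U' + V ^ 2) : ℤ)) (by
      have := congrArg (Int.cast : ℤ → ZMod 23) e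
      have h0 : ((23 : ℤ) : ZMod 23) = 0 := by decide
      rw [Int.cast_mul, h0, zero_mul] at this
      push_cast at this ⊢; exact this)
    have k1 := (ZMod.intCast_zmod_eq_zero_iff_dvd _ 23).1 k1
    have k2 := (ZMod.intCast_zmod_eq_zero_iff_dvd _ 23).1 k2
    push_cast at k1 k2
    have k3 : (23 : ℤ) ∣ U' := by
      apply p23.dvd_of_dvd_pow (n := 3)
      obtain ⟨m, hm⟩ := k1
      obtain ⟨n, hn⟩ := k2
      refine ⟨m ^ 2 + 27 * n ^ 2, ?_⟩
      rw [hm, hn] at e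
      linarith
    rcases p23.dvd_or_dvd k2 with h | h
    · exact hV23 h
    · exact hV23 (p23.dvd_of_dvd_pow ((dvd_add_right k3).1 h))
  have c23 : IsCoprime U 23 := ((Prime.coprime_iff_not_dvd p23).2 h23).symm
  by_cases h3 : (3 : ℤ) ∣ U
  · obtain ⟨U', hU'⟩ := h3
    have hW1 : (3 : ℤ) ∣ W := by
      apply p3.dvd_of_dvd_pow (n := 2)
      refine ⟨9 * U' ^ 3 - 9 * (V * (U + 23 * V ^ 2)) ^ 2, ?_⟩
      rw [hU'] at hE' ⊢; linear_combination hE'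
    obtain ⟨W1, hW1⟩ := hW1
    have hW2 : (3 : ℤ) ∣ W1 := by
      apply p3.dvd_of_dvd_pow (n := 2)
      refine ⟨U' ^ 3 - (V * (U + 23 * V ^ 2)) ^ 2, ?_⟩
      rw [hU', hW1] at hE'; rw [hU']; linarith
    obtain ⟨W', hW'⟩ := hW2
    have e : (V * (3 * U' + 23 * V ^ 2)) ^ 2 + 3 * W' ^ 2 = U' ^ 3 := by
      rw [hW1, hW', hU'] at hE'; linarith
    have hU'o : Odd U' := by rw [hU'] at hUo; exact (Int.odd_mul.1 hUo).2
    have d1 : U' ∣ U := ⟨3, by rw [hU']; ring⟩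
    have cV : IsCoprime U' V := hco.of_isCoprime_of_dvd_left d1
    have cc : IsCoprime (V * (3 * U' + 23 * V ^ 2)) U' := by
      apply IsCoprime.symm
      apply cV.mul_right
      have := ((c23.of_isCoprime_of_dvd_left d1).mul_right (cV.pow_right (n := 2))).add_mul_left_right 3
      rwa [add_comm, mul_comm U' 3] at this
    obtain ⟨u, v, hA, hB, hUU⟩ := euler_cube e hU'o cc
    have hA' : (V : ℚ) * (3 * U' + 23 * V ^ 2) = u ^ 3 - 9 * u * v ^ 2 := by exact_mod_cast hA
    have hUU' : (U' : ℚ) = u ^ 2 + 3 * v ^ 2 := by exact_mod_cast hUU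
    refine ⟨u / V, v / V, ?_, ?_⟩
    · rw [hxU, hU']; push_cast; field_simp; linear_combination hUU'
    · rw [hxU, hU']; push_cast; field_simp; linear_combination hA'
  · have c3 : IsCoprime U 3 := ((Prime.coprime_iff_not_dvd p3).2 h3).symm
    have cc : IsCoprime W U := by
      have h1 : IsCoprime U (-(27 * 529 * V ^ 6)) := by
        apply IsCoprime.neg_right
        have e : (27 * 529 : ℤ) = 3 ^ 3 * 23 ^ 2 := by norm_num
        rw [e]
        exact ((c3.pow_right).mul_right c23.pow_right).mul_right hco.pow_right
      have h2 := h1.add_mul_left_right (U ^ 2 - 27 * U * V ^ 2 - 27 * 46 * V ^ 4)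
      have h3 : W ^ 2 = -(27 * 529 * V ^ 6) + U * (U ^ 2 - 27 * U * V ^ 2 - 27 * 46 * V ^ 4) := by
        linear_combination hE
      rw [← h3] at h2
      exact ((IsCoprime.pow_right_iff two_pos).1 h2).symm
    have e : W ^ 2 + 3 * (3 * (V * (U + 23 * V ^ 2))) ^ 2 = U ^ 3 := by linarith
    obtain ⟨u, v, hA, hB, hUU⟩ := euler_cube e hUo cc
    have hB' : (V : ℚ) * (U + 23 * V ^ 2) = u ^ 2 * v - v ^ 3 := by
      have : (3 : ℚ) * (V * (U + 23 * V ^ 2)) = 3 * u ^ 2 * v - 3 * v ^ 3 := by exact_mod_cast hB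
      linarith
    have hUU' : (U : ℚ) = u ^ 2 + 3 * v ^ 2 := by exact_mod_cast hUU
    refine ⟨-v / V, u / (3 * V), ?_, ?_⟩
    · rw [hxU]; field_simp; linear_combination hUU'
    · rw [hxU]; field_simp; linear_combination 9 * hB'

lemma ds {a b : ℚ} (h : SS a b) : ∃ x y : ℚ, x ≠ 0 ∧ y ^ 2 = x ^ 3 + x ^ 2 + 2 * x + 1 ∧
    27 * tau x * (a * b) = -(tau x ^ 3 - 6 * tau x ^ 2 + 12 * tau x + 46) := by
  unfold SS at h
  obtain ⟨t, ht⟩ : ∃ t, t = 3 * (a - b) + 2 := ⟨_, rfl⟩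
  have h1 : 27 * t * (a * b) = -(t ^ 3 - 6 * t ^ 2 + 12 * t + 46) := by
    rw [ht]; linear_combination (-27) * h
  have ht0 : t ≠ 0 := by rintro rfl; norm_num at h1
  have h2 : t * ((t - 6) ^ 2 + 27 * (a + b) ^ 2) = -184 := by
    have hb : b = a - (t - 2) / 3 := by linarith
    rw [hb] at h1 ⊢
    linear_combination 4 * h1
  obtain ⟨u, v, e1, e2⟩ := dual_cube (x := -138 / t) (y := 27 * (a + b) * (-46 / t) / 2) (by
    field_simp
    linear_combination 57132 * h2)
  have hg : u + 1 ≠ 0 := by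
    intro hg
    have hu : u = -1 := by linarith
    rw [hu] at e1 e2; linarith
  have hcub : u ^ 3 - 9 * u * v ^ 2 = 23 + 3 * (u ^ 2 + 3 * v ^ 2) := by rw [← e1, ← e2]; ring
  have hE : (3 * v / (u + 1)) ^ 2 = (-3 / (u + 1)) ^ 3 + (-3 / (u + 1)) ^ 2 + 2 * (-3 / (u + 1)) + 1 := by
    field_simp
    linear_combination -hcub
  have htau : tau (-3 / (u + 1)) = t := by
    have hD : 3 * (-3 / (u + 1)) ^ 3 + 4 * (-3 / (u + 1)) ^ 2 + 12 * (-3 / (u + 1)) + 12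
        = (-3 / (u + 1)) ^ 2 * (-46 / t) := by
      have : -46 / t = u ^ 2 + 3 * v ^ 2 := by rw [← e1]; ring
      rw [this]
      field_simp
      linear_combination 3 * hcub
    have hne : (-3 / (u + 1)) ≠ 0 := div_ne_zero (by norm_num) hg
    unfold tau
    rw [hD]
    field_simp
  refine ⟨-3 / (u + 1), 3 * v / (u + 1), div_ne_zero (by norm_num) hg, hE, ?_⟩
  rw [htau]; exact h1

lemma no_SS (n : ℕ) : ∀ a b : ℚ, SS a b → - padicValRat 3 (a * b) < n → False := by
  induction n with
  | zero =>
    intro a b h hn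
    obtain ⟨x, y, hx, hE, ht⟩ := ds h
    obtain ⟨p, q, hp, hq, hp0, hpq, -⟩ := val3 hx hE
    have := val_step p q hp hp0 hq hpq ht
    rw [padicValRat.of_int] at this
    push_cast at hn
    omega
  | succ n ih =>
    intro a b h hn
    obtain ⟨x, y, hx, hE, ht⟩ := ds h
    obtain ⟨a', b', hS, htau⟩ := tr hx hE
    rw [← htau] at ht
    obtain ⟨x1, y1, hx1, hE1, ht1⟩ := ds hS
    obtain ⟨p1, q1, hp1, hq1, hp01, hpq1, -⟩ := val3 hx1 hE1
    have v1 := val_step p1 q1 hp1 hp01 hq1 hpq1 ht1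
    have hab : a' * b' ≠ 0 := by
      intro h0; rw [h0] at v1; simp at v1; omega
    have hE2 : ((a' ^ 3 + b' ^ 3) / 2) ^ 2 =
        (a' * b') ^ 3 + (a' * b') ^ 2 + 2 * (a' * b') + 1 := by
      unfold SS at hS
      linear_combination (b' ^ 3 - a' ^ 3 + 2 * (a' * b' + 1)) / 4 * hS
    obtain ⟨p, q, hp, hq, hp0, hpq, hv⟩ := val3 hab hE2
    have v2 := val_step p q hp hp0 hq hpq ht
    have v3 := hv (by rw [v1, padicValRat.of_int]; omega)
    apply ih a' b' hS
    push_cast at hn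
    omega

theorem stmt_3 (x y : ℚ) :
    y ^ 2 = x ^ 3 + x ^ 2 + 2 * x + 1 ↔ (x = 0 ∧ y = 1) ∨ (x = 0 ∧ y = -1) := by
  constructor
  · intro h
    by_cases hx : x = 0
    · subst hx
      have : y ^ 2 = 1 := by rw [h]; ring
      have h2 : (y - 1) * (y + 1) = 0 := by linear_combination this
      rcases mul_eq_zero.1 h2 with h | h
      · left; exact ⟨rfl, by linarith⟩
      · right; exact ⟨rfl, by linarith⟩
    · exfalso
      obtain ⟨a, b, hS, -⟩ := tr hx h
      exact no_SS ((- padicValRat 3 (a * b)).toNat + 1) a b hS (by push_cast; omega)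
  · rintro (⟨rfl, rfl⟩ | ⟨rfl, rfl⟩) <;> norm_num
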